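/- Let a be a positive integer, b, m, n nonnegative integers with m ≤ n, and suppose gcd(a,m) does not divide b. Then A(b,a;na,m) is not a polynomial, i.e. the polynomial (1-q^a)·∏_{i=1}^m (1-q^i)·∏_{i=1}^{na−m}(1-q^i) does not divide (1-q^b)·∏_{i=1}^{na}(1-q^i) in ℤ[q], provided na ≥ m. -/

import Mathlib

open Polynomial Finset

theorem one_sub_X_pow_ne_zero {R : Type*} [CommRing R] [Nontrivial R] {k : ℕ} (hk : 0 < k) :
    (1 - X ^ k : R[X]) ≠ 0 := by
  rw [← neg_sub, neg_ne_zero]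
  simpa using X_pow_sub_C_ne_zero hk (1 : R)

theorem prod_one_sub_X_pow_ne_zero {R : Type*} [CommRing R] [IsDomain R] (N : ℕ) :
    (∏ i ∈ range N, (1 - X ^ (i + 1)) : R[X]) ≠ 0 :=
  prod_ne_zero_iff.mpr fun i _ => one_sub_X_pow_ne_zero i.succ_pos

theorem IsPrimitiveRoot.rootMultiplicity_one_sub_X_pow {K : Type*} [Field K] [CharZero K]
    {ζ : K} {e k : ℕ} (hζ : IsPrimitiveRoot ζ e) (hk : 0 < k) :
    rootMultiplicity ζ (1 - X ^ k : K[X]) = if e ∣ k then 1 else 0 := by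
  have h0 : (1 - X ^ k : K[X]) ≠ 0 := one_sub_X_pow_ne_zero hk
  have hroot : IsRoot (1 - X ^ k : K[X]) ζ ↔ e ∣ k := by
    rw [← hζ.pow_eq_one_iff_dvd]
    rw [IsRoot, eval_sub, eval_one, eval_pow, eval_X, sub_eq_zero, eq_comm]
  split_ifs with h
  · have hsep : (1 - X ^ k : K[X]).Separable :=
      (separable_X_pow_sub_C (1 : K) (by exact_mod_cast hk.ne') one_ne_zero).of_dvd
        ⟨-1, by rw [map_one]; ring⟩
    exact le_antisymm (rootMultiplicity_le_one_of_separable hsep ζ)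
      ((rootMultiplicity_pos h0).mpr (hroot.mpr h))
  · exact rootMultiplicity_eq_zero (hroot.not.mpr h)

theorem IsPrimitiveRoot.rootMultiplicity_prod_one_sub_X_pow {K : Type*} [Field K] [CharZero K]
    {ζ : K} {e : ℕ} (hζ : IsPrimitiveRoot ζ e) (N : ℕ) :
    rootMultiplicity ζ (∏ i ∈ range N, (1 - X ^ (i + 1)) : K[X]) = N / e := by
  induction N with
  | zero => simp
  | succ N ih =>
    have h := prod_one_sub_X_pow_ne_zero (R := K) (N + 1)
    rw [prod_range_succ] at h ⊢
    rw [rootMultiplicity_mul h, ih, hζ.rootMultiplicity_one_sub_X_pow N.succ_pos, Nat.succ_div]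

theorem stmt13 (a b m n : ℕ) (ha : 0 < a) (hmn : m ≤ n) (hm : m ≤ n * a)
    (hgcd : ¬ Nat.gcd a m ∣ b) :
    ¬ (((1 - X ^ a) * (∏ i ∈ range m, (1 - X ^ (i + 1))) *
          ∏ i ∈ range (n * a - m), (1 - X ^ (i + 1)) : Polynomial ℤ) ∣
        (1 - X ^ b) * ∏ i ∈ range (n * a), (1 - X ^ (i + 1))) := by
  intro hdvd
  have hb : 0 < b := Nat.pos_of_ne_zero fun h => hgcd (h ▸ dvd_zero _)
  have he : 0 < Nat.gcd a m := Nat.gcd_pos_of_pos_left m ha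
  have hea : Nat.gcd a m ∣ a := Nat.gcd_dvd_left a m
  have hem : Nat.gcd a m ∣ m := Nat.gcd_dvd_right a m
  generalize Nat.gcd a m = e at *
  have hζ := Complex.isPrimitiveRoot_exp e he.ne'
  generalize Complex.exp (2 * Real.pi * Complex.I / e) = ζ at hζ
  have h := Polynomial.map_dvd (Int.castRingHom ℂ) hdvd
  simp only [Polynomial.map_mul, Polynomial.map_prod, Polynomial.map_sub, Polynomial.map_one,
    Polynomial.map_pow, Polynomial.map_X] at h
  have hA := one_sub_X_pow_ne_zero (R := ℂ) ha
  have hB := one_sub_X_pow_ne_zero (R := ℂ) hb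
  have hP := prod_one_sub_X_pow_ne_zero (R := ℂ)
  have hle := rootMultiplicity_le_rootMultiplicity_of_dvd (mul_ne_zero hB (hP (n * a))) h ζ
  rw [rootMultiplicity_mul (mul_ne_zero (mul_ne_zero hA (hP m)) (hP _)),
    rootMultiplicity_mul (mul_ne_zero hA (hP m)), rootMultiplicity_mul (mul_ne_zero hB (hP _)),
    hζ.rootMultiplicity_one_sub_X_pow ha, hζ.rootMultiplicity_one_sub_X_pow hb,
    hζ.rootMultiplicity_prod_one_sub_X_pow, hζ.rootMultiplicity_prod_one_sub_X_pow,
    hζ.rootMultiplicity_prod_one_sub_X_pow, if_pos hea, if_neg hgcd] at hle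
  have hdiv : m / e + (n * a - m) / e = n * a / e := by
    rw [← Nat.add_div_of_dvd_right hem, Nat.add_sub_cancel' hm]
  omega
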